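/- Let N, Q₀, Q₁, w be positive real numbers and let n be an integer. Define the weight function w_{n,N}(z) = (z−w)^{NQ₁} · (z + 1/w)^{−(N+NQ₀)} · z^{−(n+NQ₁)} for z ∈ ℂ, where all non-integer complex powers are principal branches. Then w_{n,N} is holomorphic (complex differentiable) on ℂ \ ((−∞, −1/w] ∪ [0, w]); in particular, although the individual factors (z−w)^{NQ₁} and z^{−(n+NQ₁)} have branch jumps across the segment (−1/w, 0) of the negative real axis, their product is continuous and holomorphic there. -/

import Mathlib

open Complex

theorem aux_log_sub {u v : ℂ} (hu : u.re < 0) (hv : v.re < 0) (h : u.im = v.im) :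
    Complex.log u - Complex.log v = Complex.log (-u) - Complex.log (-v) := by
  have key : Complex.arg u - Complex.arg v = Complex.arg (-u) - Complex.arg (-v) := by
    rcases lt_or_ge v.im 0 with h0 | h0
    · rw [Complex.arg_neg_eq_arg_add_pi_of_im_neg h0,
        Complex.arg_neg_eq_arg_add_pi_of_im_neg (h ▸ h0)]
      ring
    · have e : ∀ x : ℂ, x.re < 0 → 0 ≤ x.im → Complex.arg (-x) = Complex.arg x - Real.pi := by
        intro x hx hx'
        rw [Complex.arg_neg_eq_arg_sub_pi_iff]
        rcases hx'.lt_or_eq with h1 | h1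
        · exact Or.inl h1
        · exact Or.inr ⟨h1.symm, hx⟩
      rw [e u hu (h ▸ h0), e v hv h0]
      ring
  have key2 := congrArg (fun t : ℝ => (t : ℂ)) key
  push_cast at key2
  simp only [Complex.log, norm_neg]
  linear_combination Complex.I * key2

theorem aux_prod {u v : ℂ} (hu : u.re < 0) (hv : v.re < 0) (h : u.im = v.im) (a : ℂ) (n : ℤ) :
    u ^ a * v ^ (-((n : ℂ) + a)) = (-u) ^ a * (-v) ^ (-a) * v ^ (-n) := by
  have hu0 : u ≠ 0 := by rintro rfl; simp at hu
  have hv0 : v ≠ 0 := by rintro rfl; simp at hv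
  have e : -((n : ℂ) + a) = -a + ((-n : ℤ) : ℂ) := by push_cast; ring
  rw [e, Complex.cpow_add _ _ hv0, Complex.cpow_intCast, ← mul_assoc]
  congr 1
  rw [Complex.cpow_def_of_ne_zero hu0, Complex.cpow_def_of_ne_zero hv0,
    Complex.cpow_def_of_ne_zero (neg_ne_zero.2 hu0),
    Complex.cpow_def_of_ne_zero (neg_ne_zero.2 hv0), ← Complex.exp_add, ← Complex.exp_add]
  congr 1
  linear_combination a * aux_log_sub hu hv h

/-- the weight
`w_{n,N}(z) = (z−w)^{NQ₁} (z+1/w)^{−(N+NQ₀)} z^{−(n+NQ₁)}` (principal branches)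
is holomorphic on `ℂ \ ((−∞,−1/w] ∪ [0,w])`; in particular the branch jumps of the
individual factors across `(−1/w, 0)` cancel in the product. -/
theorem contour_weight_holomorphic
    (N Q₀ Q₁ w : ℝ) (hN : 0 < N) (hQ₀ : 0 < Q₀) (hQ₁ : 0 < Q₁) (hw : 0 < w)
    (n : ℤ)
    (wfun : ℂ → ℂ)
    (hwfun : wfun = fun z : ℂ =>
      (z - (w : ℂ)) ^ ((N * Q₁ : ℝ) : ℂ) *
        (z + 1 / (w : ℂ)) ^ (-((N + N * Q₀ : ℝ) : ℂ)) *
        z ^ (-(((n : ℝ) + N * Q₁ : ℝ) : ℂ))) :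
    ∀ z : ℂ,
      z ∉ (Complex.ofReal '' Set.Iic (-1 / w) ∪ Complex.ofReal '' Set.Icc 0 w) →
      DifferentiableAt ℂ wfun z := by
  intro z hz
  subst hwfun
  have hz1 : ¬ (z.im = 0 ∧ z.re ≤ -1 / w) := fun ⟨h1, h2⟩ =>
    hz (Or.inl ⟨z.re, h2, Complex.ext (by simp) (by simp [h1])⟩)
  have hz2 : ¬ (z.im = 0 ∧ 0 ≤ z.re ∧ z.re ≤ w) := fun ⟨h1, h2⟩ =>
    hz (Or.inr ⟨z.re, h2, Complex.ext (by simp) (by simp [h1])⟩)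
  have hB : z + 1 / (w : ℂ) ∈ Complex.slitPlane := by
    have e : (1 : ℂ) / (w : ℂ) = ((1 / w : ℝ) : ℂ) := by push_cast; rfl
    rw [e, Complex.mem_slitPlane_iff, Complex.add_re, Complex.add_im, Complex.ofReal_re,
      Complex.ofReal_im, add_zero]
    by_cases h : z.im = 0
    · left
      have : ¬ z.re ≤ -1 / w := fun h' => hz1 ⟨h, h'⟩
      rw [neg_div] at this
      linarith
    · exact Or.inr h
  have dB : DifferentiableAt ℂ
      (fun z : ℂ => (z + 1 / (w : ℂ)) ^ (-((N + N * Q₀ : ℝ) : ℂ))) z :=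
    (differentiableAt_id.add_const _).cpow (differentiableAt_const _) hB
  by_cases hA : z - (w : ℂ) ∈ Complex.slitPlane
  · have hC : z ∈ Complex.slitPlane := by
      rw [Complex.mem_slitPlane_iff] at hA ⊢
      simp only [Complex.sub_re, Complex.sub_im, Complex.ofReal_re, Complex.ofReal_im,
        sub_zero] at hA
      exact hA.imp (fun h => by linarith) id
    exact (((differentiableAt_id.sub_const _).cpow (differentiableAt_const _) hA).mul dB).mul
      (differentiableAt_id.cpow (differentiableAt_const _) hC)
  · have hre : z.re < 0 := by
      rw [Complex.mem_slitPlane_iff] at hA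
      simp only [Complex.sub_re, Complex.sub_im, Complex.ofReal_re, Complex.ofReal_im,
        sub_zero, not_or, not_not, not_lt] at hA
      by_contra h
      exact hz2 ⟨hA.2, not_lt.1 h, by linarith [hA.1]⟩
    have hz0 : z ≠ 0 := by rintro rfl; simp at hre
    have d : DifferentiableAt ℂ (fun z : ℂ =>
        (-(z - (w : ℂ))) ^ ((N * Q₁ : ℝ) : ℂ) * (-z) ^ (-((N * Q₁ : ℝ) : ℂ)) * z ^ (-n) *
          (z + 1 / (w : ℂ)) ^ (-((N + N * Q₀ : ℝ) : ℂ))) z := by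
      refine DifferentiableAt.mul (DifferentiableAt.mul (DifferentiableAt.mul ?_ ?_) ?_) dB
      · refine (differentiableAt_id.sub_const _).neg.cpow (differentiableAt_const _) ?_
        exact Complex.mem_slitPlane_iff.2 (Or.inl (by simp; linarith))
      · refine differentiableAt_id.neg.cpow (differentiableAt_const _) ?_
        exact Complex.mem_slitPlane_iff.2 (Or.inl (by simpa using hre))
      · exact differentiableAt_zpow.2 (Or.inl hz0)
    refine d.congr_of_eventuallyEq ?_
    have hopen : IsOpen {x : ℂ | x.re < 0} := isOpen_lt Complex.continuous_re continuous_const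
    filter_upwards [hopen.mem_nhds hre] with x hx
    have hx' : x.re < 0 := hx
    have key := aux_prod (u := x - (w : ℂ)) (v := x) (by simp; linarith) hx' (by simp)
      ((N * Q₁ : ℝ) : ℂ) n
    rw [← key]
    have e : (-(((n : ℝ) + N * Q₁ : ℝ) : ℂ)) = -((n : ℂ) + ((N * Q₁ : ℝ) : ℂ)) := by
      push_cast; rfl
    rw [e]
    ring
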